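/- There exists d₀ such that for all integers d ≥ d₀, every bipartite graph G with maximum degree at most d satisfies sd⁽³⁾(G) ≤ d − (1/1000)·√(d log d). -/

import Mathlib

open scoped Classical in
/-- Strict type 3 degeneracy of a pair `(G, f)`: an edgeless graph with positive-valued `f`
is strict type 3 degenerate, and otherwise one may apply `ReduceValue` at a vertex
(decrease `f v` by one) or `EdgeDelete` at an edge `vw` (delete the edge and decrease
`f v` by `f w`). -/
inductive SD3 {V : Type*} : SimpleGraph V → (V → ℕ) → Prop
  | base (G : SimpleGraph V) (f : V → ℕ) (h : ∀ v w, ¬ G.Adj v w) (hpos : ∀ v, 1 ≤ f v) :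
      SD3 G f
  | reduce (G : SimpleGraph V) (f : V → ℕ) (v : V)
      (h : SD3 G (Function.update f v (f v - 1))) : SD3 G f
  | edgeDel (G : SimpleGraph V) (f : V → ℕ) (v w : V) (hvw : G.Adj v w)
      (h : SD3 (G.deleteEdges {s(v, w)}) (Function.update f v (f v - f w))) : SD3 G f

/-- The strict type 3 degeneracy `sd³(G)`: the least constant `k` making `(G, k)`
strict type 3 degenerate. -/
noncomputable def sd3 {V : Type*} (G : SimpleGraph V) : ℕ :=
  sInf {k : ℕ | SD3 G (fun _ => k)}


section Reduction

open scoped Classical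

variable {V : Type*}

theorem SD3.mono [Fintype V] {G : SimpleGraph V} {f g : V → ℕ} (hg : SD3 G g) (hle : g ≤ f) :
    SD3 G f := by
  induction hn : ∑ v, f v using Nat.strong_induction_on generalizing f with
  | _ n ih =>
    by_cases heq : g = f
    · exact heq ▸ hg
    obtain ⟨v, hv⟩ : ∃ v, g v < f v := by
      by_contra! h
      exact heq (le_antisymm hle h)
    refine SD3.reduce G f v (ih _ ?_ (fun w => ?_) rfl)
    · rw [← hn]
      refine Finset.sum_lt_sum (fun w _ => ?_) ⟨v, Finset.mem_univ v, ?_⟩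
      · by_cases hw : w = v
        · subst hw; simp
        · simp [hw]
      · simp; omega
    · by_cases hw : w = v
      · subst hw; simp; omega
      · simpa [hw] using hle w

/-- The vertex `b` pays for all edges towards `P`. -/
theorem SD3.of_pay {b : V} (P : Finset V) : ∀ (G : SimpleGraph V) (f : V → ℕ),
    (∀ a ∈ P, G.Adj b a) →
    SD3 (G.deleteEdges ((fun a => s(b, a)) '' P)) (Function.update f b (f b - ∑ a ∈ P, f a)) →
    SD3 G f := by
  induction P using Finset.induction_on with
  | empty => intro G f _ h; simpa using h
  | insert a P ha ih =>
    intro G f hadj h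
    refine SD3.edgeDel G f b a (hadj a (by simp)) (ih _ _ (fun c hc => ?_) ?_)
    · rw [SimpleGraph.deleteEdges_adj]
      refine ⟨hadj c (by simp [hc]), fun hca => ha ?_⟩
      rw [Set.mem_singleton_iff, Sym2.congr_right] at hca
      exact hca ▸ hc
    · have hb : ∀ c ∈ P, c ≠ b := fun c hc hcb =>
        G.irrefl (hcb ▸ hadj c (by simp [hc]))
      have hsum : ∑ c ∈ P, Function.update f b (f b - f a) c = ∑ c ∈ P, f c :=
        Finset.sum_congr rfl fun c hc => by simp [hb c hc]
      rw [SimpleGraph.deleteEdges_deleteEdges, hsum, Function.update_idem,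
        Function.update_self, Nat.sub_sub, ← Finset.sum_insert ha]
      convert h using 2
      ext e
      simp [eq_comm]

/-- When `b` carries a single token, all vertices of `Q` pay one token for their edge to `b`. -/
theorem SD3.of_charge {b : V} (Q : Finset V) : ∀ (G : SimpleGraph V) (f : V → ℕ), f b = 1 →
    (∀ a ∈ Q, G.Adj b a) →
    SD3 (G.deleteEdges ((fun a => s(b, a)) '' Q)) (fun x => if x ∈ Q then f x - 1 else f x) →
    SD3 G f := by
  induction Q using Finset.induction_on with
  | empty => intro G f _ _ h; simpa using h
  | insert a Q ha ih =>
    intro G f hb hadj h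
    have hab : b ≠ a := (hadj a (by simp)).ne
    refine SD3.edgeDel G f a b (hadj a (by simp)).symm (ih _ _ ?_ (fun c hc => ?_) ?_)
    · simp [hab, hb]
    · rw [SimpleGraph.deleteEdges_adj]
      refine ⟨hadj c (by simp [hc]), fun hca => ha ?_⟩
      rw [Set.mem_singleton_iff, Sym2.eq_swap, Sym2.congr_left] at hca
      exact hca ▸ hc
    · rw [SimpleGraph.deleteEdges_deleteEdges]
      convert h using 2
      · ext e
        simp [eq_comm, Sym2.eq_swap]
      · rename_i x
        by_cases hx : x = a
        · subst hx; simp [ha, hb]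
        · simp [hx]

/-- The graph `G` with all edges leaving `R` removed. -/
def SimpleGraph.keep (G : SimpleGraph V) (R : Finset V) : SimpleGraph V where
  Adj u v := G.Adj u v ∧ u ∈ R ∧ v ∈ R
  symm := ⟨fun _ _ h => ⟨h.1.symm, h.2.2, h.2.1⟩⟩
  loopless := ⟨fun _ h => G.irrefl h.1⟩

/-- Treat the vertex `b` completely: it pays for the edges towards `P`, drops to one token,
and its other neighbors `Q` pay one token each. -/
theorem SD3.of_keep_erase [Fintype V] {G : SimpleGraph V} {R P Q : Finset V} {b : V}
    {f g : V → ℕ} (hPQ : ∀ a, (G.keep R).Adj b a ↔ a ∈ P ∨ a ∈ Q) (hdisj : Disjoint P Q)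
    (hpay : ∑ a ∈ P, f a < f b) (hb : g b ≤ 1) (hQ : ∀ a ∈ Q, g a ≤ f a - 1)
    (hother : ∀ a, a ≠ b → a ∉ Q → g a ≤ f a)
    (h : SD3 (G.keep (R.erase b)) g) : SD3 (G.keep R) f := by
  have hbP : b ∉ P := fun hb => (G.keep R).irrefl ((hPQ b).2 (Or.inl hb))
  have hbQ : b ∉ Q := fun hb => (G.keep R).irrefl ((hPQ b).2 (Or.inr hb))
  refine SD3.of_pay P _ _ (fun a ha => (hPQ a).2 (Or.inl ha)) ?_
  refine SD3.mono (g := Function.update f b 1) ?_ ?_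
  · refine SD3.of_charge (b := b) Q _ _ (Function.update_self ..) (fun a ha => ?_) ?_
    · rw [SimpleGraph.deleteEdges_adj]
      refine ⟨(hPQ a).2 (Or.inr ha), ?_⟩
      rintro ⟨c, hc, hca⟩
      rw [Sym2.congr_right] at hca
      exact Finset.disjoint_left.1 hdisj hc (hca ▸ ha)
    · have hG : ((G.keep R).deleteEdges ((fun a => s(b, a)) '' P)).deleteEdges
          ((fun a => s(b, a)) '' Q) = G.keep (R.erase b) := by
        ext u v
        simp only [SimpleGraph.deleteEdges_adj, Set.mem_image, Finset.mem_coe]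
        constructor
        · rintro ⟨⟨huv, hP⟩, hQ'⟩
          have key : ∀ u v, (G.keep R).Adj u v → (¬ ∃ x ∈ P, s(b, x) = s(u, v)) →
              (¬ ∃ x ∈ Q, s(b, x) = s(u, v)) → u ≠ b := by
            rintro u v huv h1 h2 rfl
            rcases (hPQ v).1 huv with h | h
            · exact h1 ⟨v, h, rfl⟩
            · exact h2 ⟨v, h, rfl⟩
          refine ⟨huv.1, Finset.mem_erase.2 ⟨key u v huv hP hQ', huv.2.1⟩,
            Finset.mem_erase.2 ⟨key v u huv.symm ?_ ?_, huv.2.2⟩⟩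
          · rwa [Sym2.eq_swap]
          · rwa [Sym2.eq_swap]
        · rintro ⟨huv, hu, hv⟩
          rw [Finset.mem_erase] at hu hv
          have key : ∀ x, s(b, x) ≠ s(u, v) := by
            intro x hx
            rcases Sym2.eq_iff.1 hx with ⟨h, _⟩ | ⟨h, _⟩
            · exact hu.1 h.symm
            · exact hv.1 h.symm
          exact ⟨⟨⟨huv, hu.2, hv.2⟩, fun ⟨x, _, hx⟩ => key x hx⟩, fun ⟨x, _, hx⟩ => key x hx⟩
      rw [hG]
      refine h.mono fun x => ?_
      by_cases hx : x = b
      · subst hx; simpa [hbQ] using hb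
      · by_cases hxQ : x ∈ Q
        · simpa [hxQ, hx] using hQ x hxQ
        · simpa [hxQ, hx] using hother x hx hxQ
  · intro x
    by_cases hx : x = b
    · subst hx; simp only [Function.update_self]; omega
    · simp [hx]

/-- The neighbors of `a` of smaller rank which do not pay for their edge to `a`. -/
noncomputable def unpaid [Fintype V] (G : SimpleGraph V) (ρ : V → ℕ) (P : V → Finset V) (a : V) :
    Finset V :=
  {u | G.Adj u a ∧ ρ u < ρ a ∧ a ∉ P u}

/-- An upper bound for what `b` pays for the edges towards `P b`. -/
noncomputable def payment [Fintype V] (G : SimpleGraph V) (ρ : V → ℕ) (P : V → Finset V) (b : V) :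
    ℕ :=
  ∑ a ∈ P b, (1 + ((unpaid G ρ P a).filter fun u => ρ b ≤ ρ u).card)

/-- A removal scheme: vertices are treated by increasing rank `ρ`, and when `b` is treated, it
pays for the edges towards `P b`. -/
theorem SD3.of_scheme [Fintype V] {G : SimpleGraph V} (ρ : V → ℕ) (P : V → Finset V) (k : ℕ)
    (hρ : ∀ u v, G.Adj u v → ρ u ≠ ρ v) (hadj : ∀ b, ∀ a ∈ P b, G.Adj b a)
    (hempty : ∀ b, ∀ a ∈ P b, P a = ∅)
    (hk : ∀ v, (unpaid G ρ P v).card + payment G ρ P v + 1 ≤ k) : SD3 G fun _ => k := by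
  have main : ∀ R : Finset V, SD3 (G.keep R) fun v =>
      if v ∈ R then 1 + payment G ρ P v + (unpaid G ρ P v ∩ R).card else 1 := by
    intro R
    induction hn : R.card using Nat.strong_induction_on generalizing R with
    | _ n ih =>
      rcases R.eq_empty_or_nonempty with rfl | hne
      · exact SD3.base _ _ (fun v w h => by simpa using h.2.1) (by simp)
      obtain ⟨b, hbR, hmin⟩ := R.exists_min_image ρ hne
      have hlt : ∀ a ∈ R, G.Adj b a → ρ b < ρ a := fun a ha hba =>
        lt_of_le_of_ne (hmin a ha) (hρ b a hba)
      refine SD3.of_keep_erase (b := b) (P := P b ∩ R)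
        (Q := {a ∈ R | G.Adj b a ∧ a ∉ P b}) ?_ ?_ ?_ ?_ ?_ ?_
        (ih (R.erase b).card (hn ▸ Finset.card_erase_lt_of_mem hbR) _ rfl)
      · intro a
        simp only [SimpleGraph.keep, Finset.mem_inter, Finset.mem_filter, hbR, true_and]
        have := hadj b a
        tauto
      · rw [Finset.disjoint_left]
        intro a ha ha'
        simp at ha ha'
        exact ha'.2.2 ha.1
      · rw [if_pos hbR, add_assoc, Nat.lt_one_add_iff]
        refine le_trans ?_ (Nat.le_add_right _ _)
        refine (Finset.sum_le_sum fun a ha => ?_).trans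
          (Finset.sum_le_sum_of_subset Finset.inter_subset_left)
        rw [Finset.mem_inter] at ha
        have h0 : payment G ρ P a = 0 := by simp [payment, hempty b a ha.1]
        simp only [if_pos ha.2, h0, add_zero]
        gcongr
        intro u hu
        rw [Finset.mem_inter] at hu
        exact Finset.mem_filter.2 ⟨hu.1, hmin u hu.2⟩
      · simp
      · intro a ha
        simp only [Finset.mem_filter] at ha
        have hmem : b ∈ unpaid G ρ P a ∩ R := by
          simp [unpaid, hbR, ha.2, hlt a ha.1 ha.2.1]
        have hne : a ≠ b := ha.2.1.ne'
        rw [if_pos ha.1, if_pos (Finset.mem_erase.2 ⟨hne, ha.1⟩), Finset.inter_erase,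
          Finset.card_erase_of_mem hmem]
        have := Finset.card_pos.2 ⟨b, hmem⟩
        omega
      · intro a hab _
        by_cases haR : a ∈ R
        · rw [if_pos haR, if_pos (Finset.mem_erase.2 ⟨hab, haR⟩)]
          gcongr
          exact Finset.erase_subset _ _
        · simp [haR]
  have huniv : G.keep Finset.univ = G := by ext; simp [SimpleGraph.keep]
  have := main Finset.univ
  rw [huniv] at this
  refine this.mono fun v => ?_
  have := hk v
  simp
  omega

end Reduction

section LocalLemma

open Finset

variable {V K : Type*} [Fintype V] [DecidableEq V] [Fintype K] [DecidableEq K]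

/-- `E` is determined by the coordinates in `S`. -/
def DependsOnlyOn (E : Finset (V → K)) (S : Finset V) : Prop :=
  ∀ x y : V → K, (∀ v ∈ S, x v = y v) → (x ∈ E ↔ y ∈ E)

theorem card_inter_mul_card_univ {E F : Finset (V → K)} {S T : Finset V}
    (hE : DependsOnlyOn E S) (hF : DependsOnlyOn F T) (hST : Disjoint S T) :
    (E ∩ F).card * (univ : Finset (V → K)).card = E.card * F.card := by
  rw [← card_product, ← card_product]
  let σ : (V → K) × (V → K) → (V → K) × (V → K) := fun p =>
    (fun v => if v ∈ S then p.1 v else p.2 v, fun v => if v ∈ S then p.2 v else p.1 v)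
  have hσ : ∀ p, σ (σ p) = p := by
    rintro ⟨x, y⟩
    refine Prod.ext (funext fun v => ?_) (funext fun v => ?_) <;>
      by_cases hv : v ∈ S <;> simp [σ, hv]
  have hS : ∀ x y : V → K, (fun v => if v ∈ S then x v else y v) ∈ E ↔ x ∈ E := fun x y =>
    hE _ _ fun v hv => by simp [hv]
  have hT : ∀ x y : V → K, (fun v => if v ∈ S then x v else y v) ∈ F ↔ y ∈ F := fun x y =>
    hF _ _ fun v hv => by simp [disjoint_right.1 hST hv]
  refine card_nbij' σ σ ?_ ?_ (fun p _ => hσ p) (fun p _ => hσ p)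
  · rintro ⟨x, y⟩ h
    simp only [coe_product, Set.mem_prod, mem_coe, mem_inter, mem_univ, and_true] at h
    simp only [coe_product, Set.mem_prod, mem_coe, σ]
    rw [hS, hT]
    exact h
  · rintro ⟨x, y⟩ h
    simp only [coe_product, Set.mem_prod, mem_coe] at h
    simp only [coe_product, Set.mem_prod, mem_coe, mem_inter, mem_univ, and_true, σ]
    rw [hS, hT]
    exact h

/-- The assignments avoiding all events `E i` with `i ∈ T`. -/
def avoiding {ι : Type*} (E : ι → Finset (V → K)) (T : Finset ι) : Finset (V → K) :=
  {x | ∀ i ∈ T, x ∉ E i}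

theorem mem_avoiding {ι : Type*} {E : ι → Finset (V → K)} {T : Finset ι} {x : V → K} :
    x ∈ avoiding E T ↔ ∀ i ∈ T, x ∉ E i := by
  simp [avoiding]

theorem dependsOnlyOn_avoiding {ι : Type*} {E : ι → Finset (V → K)} {S : ι → Finset V}
    (hE : ∀ i, DependsOnlyOn (E i) (S i)) (T : Finset ι) :
    DependsOnlyOn (avoiding E T) (T.biUnion S) := by
  intro x y hxy
  rw [mem_avoiding, mem_avoiding]
  refine forall₂_congr fun i hi => not_congr (hE i x y fun v hv => hxy v ?_)
  exact mem_biUnion.2 ⟨i, hi, hv⟩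

theorem avoiding_subset {ι : Type*} (E : ι → Finset (V → K)) {T U : Finset ι} (h : T ⊆ U) :
    avoiding E U ⊆ avoiding E T := by
  intro x hx
  rw [mem_avoiding] at hx ⊢
  exact fun i hi => hx i (h hi)

variable [Nonempty K]

theorem card_inter_avoiding_le {ι : Type*} [Fintype ι] [DecidableEq ι]
    {E : ι → Finset (V → K)} {S : ι → Finset V} (hE : ∀ i, DependsOnlyOn (E i) (S i))
    {p : ℝ} {D : ℕ} (hp : ∀ i, ((E i).card : ℝ) ≤ p * (univ : Finset (V → K)).card)
    (hD : ∀ i, (univ.filter fun j => ¬ Disjoint (S i) (S j)).card ≤ D)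
    (hp0 : 0 ≤ p) (hpD : 4 * p * D ≤ 1) (T : Finset ι) (i : ι) :
    ((E i ∩ avoiding E T).card : ℝ) ≤ 2 * p * (avoiding E T).card := by
  induction hn : T.card using Nat.strong_induction_on generalizing T i with
  | _ n ih =>
    set T₂ := T.filter fun j => Disjoint (S i) (S j) with hT₂
    set T₁ := T.filter fun j => ¬ Disjoint (S i) (S j) with hT₁
    have hindep : ((E i ∩ avoiding E T₂).card : ℝ) ≤ p * (avoiding E T₂).card := by
      have h := card_inter_mul_card_univ (hE i) (dependsOnlyOn_avoiding hE T₂)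
        (by
          rw [disjoint_biUnion_right]
          exact fun j hj => (mem_filter.1 hj).2)
      have hpos : (0 : ℝ) < (univ : Finset (V → K)).card := by
        exact_mod_cast card_pos.2 univ_nonempty
      have h' : ((E i ∩ avoiding E T₂).card : ℝ) * (univ : Finset (V → K)).card =
          (E i).card * (avoiding E T₂).card := by exact_mod_cast h
      refine le_of_mul_le_mul_right ?_ hpos
      rw [h', mul_right_comm]
      exact mul_le_mul_of_nonneg_right (hp i) (Nat.cast_nonneg _)
    have hsub : ((E i ∩ avoiding E T).card : ℝ) ≤ (E i ∩ avoiding E T₂).card := by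
      exact_mod_cast card_le_card
        (inter_subset_inter_left (avoiding_subset E (filter_subset _ _)))
    suffices hhalf : ((avoiding E T₂).card : ℝ) ≤ 2 * (avoiding E T).card by
      nlinarith [mul_le_mul_of_nonneg_left hhalf hp0]
    have hcover : avoiding E T₂ ⊆
        avoiding E T ∪ T₁.biUnion fun j => E j ∩ avoiding E T₂ := by
      intro x hx
      by_cases hxT : x ∈ avoiding E T
      · exact mem_union_left _ hxT
      · refine mem_union_right _ ?_
        simp only [mem_avoiding, not_forall, not_not] at hxT
        obtain ⟨j, hj, hxj⟩ := hxT
        refine mem_biUnion.2 ⟨j, mem_filter.2 ⟨hj, fun hdis => ?_⟩, mem_inter.2 ⟨hxj, hx⟩⟩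
        exact mem_avoiding.1 hx j (mem_filter.2 ⟨hj, hdis⟩) hxj
    by_cases hempty : T₁ = ∅
    · have : avoiding E T₂ ⊆ avoiding E T := by simpa [hempty] using hcover
      have h1 : ((avoiding E T₂).card : ℝ) ≤ (avoiding E T).card := by
        exact_mod_cast card_le_card this
      linarith [Nat.cast_nonneg (α := ℝ) (avoiding E T).card]
    have hlt : T₂.card < n := by
      obtain ⟨j, hj⟩ := nonempty_iff_ne_empty.2 hempty
      rw [← hn]
      refine card_lt_card ⟨filter_subset _ _, fun h => ?_⟩
      exact (mem_filter.1 hj).2 (mem_filter.1 (h (mem_filter.1 hj).1)).2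
    have hcard : ((avoiding E T₂).card : ℝ) ≤
        (avoiding E T).card + ∑ j ∈ T₁, ((E j ∩ avoiding E T₂).card : ℝ) := by
      exact_mod_cast (card_le_card hcover).trans ((card_union_le _ _).trans
        (Nat.add_le_add_left card_biUnion_le _))
    have hsum : ∑ j ∈ T₁, ((E j ∩ avoiding E T₂).card : ℝ) ≤
        D * (2 * p * (avoiding E T₂).card) := by
      refine (sum_le_card_nsmul _ _ _ fun j _ => ih _ hlt T₂ j rfl).trans ?_
      rw [nsmul_eq_mul]
      refine mul_le_mul_of_nonneg_right ?_ (by positivity)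
      exact_mod_cast (card_le_card (filter_subset_filter _ (subset_univ T))).trans (hD i)
    nlinarith [mul_le_mul_of_nonneg_right hpD (Nat.cast_nonneg (α := ℝ) (avoiding E T₂).card)]

/-- The symmetric Lovász local lemma for uniformly random assignments `V → K`. -/
theorem exists_forall_notMem_of_local {ι : Type*} [Fintype ι] [DecidableEq ι]
    {E : ι → Finset (V → K)} {S : ι → Finset V} (hE : ∀ i, DependsOnlyOn (E i) (S i))
    {p : ℝ} {D : ℕ} (hp : ∀ i, ((E i).card : ℝ) ≤ p * (univ : Finset (V → K)).card)
    (hD : ∀ i, (univ.filter fun j => ¬ Disjoint (S i) (S j)).card ≤ D)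
    (hp0 : 0 ≤ p) (hp1 : 2 * p < 1) (hpD : 4 * p * D ≤ 1) : ∃ x, ∀ i, x ∉ E i := by
  have main : ∀ T : Finset ι, 0 < (avoiding E T).card := by
    intro T
    induction T using Finset.induction_on with
    | empty => simpa [avoiding] using card_pos.2 (univ_nonempty (α := V → K))
    | insert i T _ ih =>
      have hsplit : avoiding E T ⊆ avoiding E (insert i T) ∪ E i ∩ avoiding E T := by
        intro x hx
        by_cases hxi : x ∈ E i
        · exact mem_union_right _ (mem_inter.2 ⟨hxi, hx⟩)
        · refine mem_union_left _ ?_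
          rw [mem_avoiding] at hx ⊢
          simpa [hxi] using hx
      have h1 : ((avoiding E T).card : ℝ) ≤
          (avoiding E (insert i T)).card + (E i ∩ avoiding E T).card := by
        exact_mod_cast (card_le_card hsplit).trans (card_union_le _ _)
      have h2 := card_inter_avoiding_le hE hp hD hp0 hpD T i
      have ih' : (0 : ℝ) < (avoiding E T).card := by exact_mod_cast ih
      have : (0 : ℝ) < (avoiding E (insert i T)).card := by nlinarith
      exact_mod_cast this
  obtain ⟨x, hx⟩ := card_pos.1 (main univ)
  exact ⟨x, fun i => mem_avoiding.1 hx i (mem_univ i)⟩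

end LocalLemma

section Splitting

open Finset

variable {V K : Type*} [Fintype V] [DecidableEq V] [Fintype K] [DecidableEq K]

theorem sum_pow_card_filter_eq [Nonempty K] (S : Finset V) (c : K) (r : ℝ) :
    ∑ x : V → K, r ^ (S.filter fun w => x w = c).card =
      (univ : Finset (V → K)).card * (1 + (r - 1) / Fintype.card K) ^ S.card := by
  have hN : (Fintype.card K : ℝ) ≠ 0 := by exact_mod_cast Fintype.card_ne_zero
  have hx : ∀ x : V → K, r ^ (S.filter fun w => x w = c).card =
      ∏ w, if w ∈ S then (if x w = c then r else 1) else 1 := by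
    intro x
    rw [prod_ite_mem, univ_inter, prod_ite]
    simp
  have hsum : ∀ w : V, ∑ k : K, (if w ∈ S then (if k = c then r else 1) else (1 : ℝ)) =
      Fintype.card K * (if w ∈ S then 1 + (r - 1) / Fintype.card K else 1) := by
    intro w
    split_ifs
    · have : ∀ k : K, (if k = c then r else (1 : ℝ)) = 1 + if k = c then r - 1 else 0 := by
        intro k; split_ifs <;> ring
      simp only [this, sum_add_distrib, sum_ite_eq', mem_univ, if_true, sum_const, card_univ,
        nsmul_eq_mul]
      field_simp
    · simp
  simp only [hx]
  have := prod_univ_sum (fun _ : V => (univ : Finset K))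
    fun w k => if w ∈ S then (if k = c then r else 1) else (1 : ℝ)
  rw [Fintype.piFinset_univ] at this
  rw [← this]
  simp only [hsum, prod_mul_distrib, prod_const, prod_ite_mem, univ_inter, card_univ,
    Fintype.card_fun, Nat.cast_pow]

theorem card_many_le [Nonempty K] {S : Finset V} {d : ℝ} (hS : (S.card : ℝ) ≤ d) (c : K) :
    ((univ.filter fun x : V → K =>
      2 * (d / Fintype.card K) < ((S.filter fun w => x w = c).card : ℝ)).card : ℝ) ≤
      Real.exp (-(d / Fintype.card K) / 8) * (univ : Finset (V → K)).card := by
  have hN : (0 : ℝ) < Fintype.card K := by exact_mod_cast Fintype.card_pos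
  have hd : 0 ≤ d := (Nat.cast_nonneg _).trans hS
  set y := d / Fintype.card K with hy
  have hy0 : 0 ≤ y := by positivity
  have h1 : ((univ.filter fun x : V → K =>
      2 * y < ((S.filter fun w => x w = c).card : ℝ)).card : ℝ) * Real.exp (9 / 8 * y) ≤
      (univ : Finset (V → K)).card * Real.exp y := by
    calc _ ≤ ∑ x ∈ univ.filter fun x : V → K =>
          2 * y < ((S.filter fun w => x w = c).card : ℝ),
          (2 : ℝ) ^ (S.filter fun w => x w = c).card := by
          rw [← nsmul_eq_mul]
          refine card_nsmul_le_sum _ _ _ fun x hx => ?_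
          have hx' := (mem_filter.1 hx).2
          rw [← Real.exp_log (show (0 : ℝ) < 2 by norm_num), ← Real.exp_nat_mul, Real.exp_le_exp]
          nlinarith [Real.log_two_gt_d9]
      _ ≤ ∑ x : V → K, (2 : ℝ) ^ (S.filter fun w => x w = c).card :=
          sum_le_sum_of_subset_of_nonneg (filter_subset _ _) fun _ _ _ => by positivity
      _ ≤ _ := by
          rw [sum_pow_card_filter_eq]
          gcongr
          calc (1 + (2 - 1) / (Fintype.card K : ℝ)) ^ S.card
              ≤ Real.exp (1 / Fintype.card K) ^ S.card := by
                gcongr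
                rw [show (2 : ℝ) - 1 = 1 by norm_num, add_comm]
                exact Real.add_one_le_exp _
            _ ≤ Real.exp y := by
                rw [← Real.exp_nat_mul, Real.exp_le_exp, hy, mul_one_div]
                gcongr
  have h2 : Real.exp y = Real.exp (-y / 8) * Real.exp (9 / 8 * y) := by
    rw [← Real.exp_add]; ring_nf
  rw [h2] at h1
  refine le_of_mul_le_mul_right ?_ (Real.exp_pos (9 / 8 * y))
  linarith

theorem card_few_le [Nonempty K] {S : Finset V} {d : ℝ} (hd : 0 ≤ d) (hS : d / 2 ≤ S.card)
    (c : K) :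
    ((univ.filter fun x : V → K =>
      ((S.filter fun w => x w = c).card : ℝ) < d / Fintype.card K / 8).card : ℝ) ≤
      Real.exp (-(d / Fintype.card K) / 8) * (univ : Finset (V → K)).card := by
  have hN : (0 : ℝ) < Fintype.card K := by exact_mod_cast Fintype.card_pos
  have hN1 : (1 : ℝ) ≤ Fintype.card K := by exact_mod_cast Fintype.card_pos
  set y := d / Fintype.card K with hy
  have hy0 : 0 ≤ y := by positivity
  have h1 : ((univ.filter fun x : V → K =>
      ((S.filter fun w => x w = c).card : ℝ) < y / 8).card : ℝ) * Real.exp (-y / 8) ≤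
      (univ : Finset (V → K)).card * Real.exp (-y / 4) := by
    calc _ ≤ ∑ x ∈ univ.filter fun x : V → K =>
          ((S.filter fun w => x w = c).card : ℝ) < y / 8,
          (1 / 2 : ℝ) ^ (S.filter fun w => x w = c).card := by
          rw [← nsmul_eq_mul]
          refine card_nsmul_le_sum _ _ _ fun x hx => ?_
          have hx' := (mem_filter.1 hx).2
          rw [← Real.exp_log (show (0 : ℝ) < 1 / 2 by norm_num), ← Real.exp_nat_mul,
            Real.exp_le_exp, one_div, Real.log_inv]
          nlinarith [Real.log_two_gt_d9, Real.log_two_lt_d9,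
            Nat.cast_nonneg (α := ℝ) (S.filter fun w => x w = c).card]
      _ ≤ ∑ x : V → K, (1 / 2 : ℝ) ^ (S.filter fun w => x w = c).card :=
          sum_le_sum_of_subset_of_nonneg (filter_subset _ _) fun _ _ _ => by positivity
      _ ≤ _ := by
          rw [sum_pow_card_filter_eq]
          gcongr
          have hle : (1 : ℝ) / Fintype.card K ≤ 1 := by
            rw [div_le_one hN]; exact hN1
          have heq : (1 / 2 - 1) / (Fintype.card K : ℝ) = -(1 / Fintype.card K / 2) := by ring
          calc (1 + (1 / 2 - 1) / (Fintype.card K : ℝ)) ^ S.card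
              ≤ Real.exp ((1 / 2 - 1) / Fintype.card K) ^ S.card := by
                gcongr
                · rw [heq]; linarith
                · rw [add_comm]
                  exact Real.add_one_le_exp _
            _ ≤ Real.exp (-y / 4) := by
                rw [← Real.exp_nat_mul, Real.exp_le_exp, heq, hy]
                have : d / 2 / Fintype.card K ≤ S.card / Fintype.card K := by gcongr
                have e1 : (S.card : ℝ) * -(1 / (Fintype.card K : ℝ) / 2) =
                    -(S.card / Fintype.card K) / 2 := by ring
                have e2 : d / 2 / (Fintype.card K : ℝ) = d / Fintype.card K / 2 := by ring
                rw [e1]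
                linarith
  have h2 : Real.exp (-y / 4) = Real.exp (-y / 8) * Real.exp (-y / 8) := by
    rw [← Real.exp_add]; ring_nf
  rw [h2] at h1
  refine le_of_mul_le_mul_right ?_ (Real.exp_pos (-y / 8))
  linarith

/-- A graph of maximum degree at most `d` has a vertex coloring for which every neighborhood
contains about the expected number of vertices of each color. -/
theorem exists_balanced_coloring [Nonempty K] (G : SimpleGraph V) [DecidableRel G.Adj] {d : ℕ}
    (hd : ∀ v, G.degree v ≤ d) (hd1 : 1 ≤ d)
    (hK : 8 * (d : ℝ) ^ 2 * Fintype.card K * Real.exp (-((d : ℝ) / Fintype.card K) / 8) ≤ 1) :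
    ∃ x : V → K, ∀ v c,
      (((G.neighborFinset v).filter fun w => x w = c).card : ℝ) ≤ 2 * ((d : ℝ) / Fintype.card K) ∧
      ((d : ℝ) / 2 ≤ G.degree v →
        (d : ℝ) / Fintype.card K / 8 ≤ ((G.neighborFinset v).filter fun w => x w = c).card) := by
  classical
  set e := Real.exp (-((d : ℝ) / Fintype.card K) / 8) with he
  have he0 : 0 < e := Real.exp_pos _
  have hK1 : (1 : ℝ) ≤ Fintype.card K := by exact_mod_cast Fintype.card_pos
  have hd1' : (1 : ℝ) ≤ d := by exact_mod_cast hd1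
  let E : V → Finset (V → K) := fun v => univ.filter fun x => ∃ c,
    2 * ((d : ℝ) / Fintype.card K) < ((G.neighborFinset v).filter fun w => x w = c).card ∨
    ((d : ℝ) / 2 ≤ G.degree v ∧
      (((G.neighborFinset v).filter fun w => x w = c).card : ℝ) < (d : ℝ) / Fintype.card K / 8)
  have key : ∃ x, ∀ v, x ∉ E v := by
    refine exists_forall_notMem_of_local (S := fun v => G.neighborFinset v)
      (p := 2 * Fintype.card K * e) (D := d ^ 2) ?_ ?_ ?_ (by positivity) ?_ ?_
    · intro v x y hxy
      simp only [E, mem_filter, mem_univ, true_and]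
      have : ∀ c, ((G.neighborFinset v).filter fun w => x w = c) =
          (G.neighborFinset v).filter fun w => y w = c := fun c =>
        filter_congr fun w hw => by rw [hxy w hw]
      simp only [this]
    · intro v
      have hsub : E v ⊆ univ.biUnion fun c : K =>
          (univ.filter fun x : V → K => 2 * ((d : ℝ) / Fintype.card K) <
            ((G.neighborFinset v).filter fun w => x w = c).card) ∪
          (univ.filter fun x : V → K => (d : ℝ) / 2 ≤ G.degree v ∧
            (((G.neighborFinset v).filter fun w => x w = c).card : ℝ) <
              (d : ℝ) / Fintype.card K / 8) := by
        intro x hx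
        simpa [E] using hx
      have hc : ∀ c : K, (((univ.filter fun x : V → K => 2 * ((d : ℝ) / Fintype.card K) <
            ((G.neighborFinset v).filter fun w => x w = c).card) ∪
          (univ.filter fun x : V → K => (d : ℝ) / 2 ≤ G.degree v ∧
            (((G.neighborFinset v).filter fun w => x w = c).card : ℝ) <
              (d : ℝ) / Fintype.card K / 8)).card : ℝ) ≤
            2 * e * (univ : Finset (V → K)).card := by
        intro c
        refine (Nat.cast_le.2 (card_union_le _ _)).trans ?_
        rw [Nat.cast_add]
        have h1 := card_many_le (K := K) (S := G.neighborFinset v) (d := d)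
          (by exact_mod_cast hd v) c
        have h2 : ((univ.filter fun x : V → K => (d : ℝ) / 2 ≤ G.degree v ∧
            (((G.neighborFinset v).filter fun w => x w = c).card : ℝ) <
              (d : ℝ) / Fintype.card K / 8).card : ℝ) ≤ e * (univ : Finset (V → K)).card := by
          by_cases hdeg : (d : ℝ) / 2 ≤ G.degree v
          · simpa only [hdeg, true_and] using card_few_le (K := K) (S := G.neighborFinset v)
              (d := d) (by positivity) hdeg c
          · simp only [hdeg, false_and, filter_false, card_empty, Nat.cast_zero]
            positivity
        linarith
      calc ((E v).card : ℝ) ≤ ∑ c : K, _ := by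
            exact_mod_cast (card_le_card hsub).trans card_biUnion_le
        _ ≤ ∑ c : K, 2 * e * (univ : Finset (V → K)).card := sum_le_sum fun c _ => hc c
        _ = _ := by simp; ring
    · intro v
      have hsub : (univ.filter fun w => ¬ Disjoint (G.neighborFinset v) (G.neighborFinset w)) ⊆
          (G.neighborFinset v).biUnion fun u => G.neighborFinset u := by
        intro w hw
        obtain ⟨u, hu, hu'⟩ := not_disjoint_iff.1 (mem_filter.1 hw).2
        refine mem_biUnion.2 ⟨u, hu, ?_⟩
        rw [SimpleGraph.mem_neighborFinset] at hu' ⊢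
        exact hu'.symm
      refine (card_le_card hsub).trans ((card_biUnion_le_card_mul _ _ d fun u _ => hd u).trans ?_)
      rw [pow_two]
      exact Nat.mul_le_mul_right _ (hd v)
    · have : (1 : ℝ) ≤ (d : ℝ) ^ 2 := one_le_pow₀ hd1'
      nlinarith [mul_le_mul_of_nonneg_right this (show 0 ≤ 8 * Fintype.card K * e by positivity)]
    · push_cast
      linarith
  obtain ⟨x, hx⟩ := key
  refine ⟨x, fun v c => ?_⟩
  have := hx v
  simp only [E, mem_filter, mem_univ, true_and, not_exists, not_or, not_lt, not_and] at this
  exact this c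

end Splitting

section Scheme

open Finset

open scoped Classical in
/-- A removal scheme for bipartite graphs, given a partition of both sides of the graph into parts
indexed by `π`. The vertices `b` with `side b = false` and `π b = i ∈ [1, m]` pay for their edges
to the vertices `a` with `side a = true` and `π a = i`. -/
theorem SD3.of_parts {V : Type*} [Fintype V] {G : SimpleGraph V} {side : V → Bool}
    (hside : ∀ u v, G.Adj u v → side u ≠ side v) {d s m : ℕ} (hs : s + 1 ≤ d)
    (hdeg : ∀ v, G.degree v ≤ d) (π : V → ℕ) (hπ : ∀ a, side a = true → π a ≤ m) (M : ℕ → ℕ)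
    (hA : ∀ a, side a = true → ∀ j ≤ m, d ≤ G.degree a + s →
      s + 1 ≤ ((G.neighborFinset a).filter fun w => π w = j).card)
    (hB : ∀ b, side b = false → d ≤ G.degree b + s →
      s + 1 ≤ ((G.neighborFinset b).filter fun w => 1 ≤ π w ∧ π w ≤ m).card)
    (hM : ∀ a, side a = true → ∀ i, 1 ≤ i → i ≤ m →
      ((G.neighborFinset a).filter fun w => π w ≤ i).card ≤ M i)
    (hpay : ∀ b, side b = false → ∀ i, 1 ≤ i → i ≤ m →
      ((G.neighborFinset b).filter fun w => π w = i).card * (1 + M i) + s + 1 ≤ d) :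
    SD3 G fun _ => d - s := by
  let ρ : V → ℕ := fun v =>
    if side v = true then (if π v = 0 then m + 1 else m + 3)
    else (if π v = 0 then m + 2 else m + 1 - π v)
  have hρA : ∀ v, side v = true → π v = 0 ∧ ρ v = m + 1 ∨ π v ≠ 0 ∧ ρ v = m + 3 := by
    intro v hv
    by_cases h0 : π v = 0 <;> simp [ρ, hv, h0]
  have hρB : ∀ v, side v = false → π v = 0 ∧ ρ v = m + 2 ∨ π v ≠ 0 ∧ ρ v = m + 1 - π v := by
    intro v hv
    by_cases h0 : π v = 0 <;> simp [ρ, hv, h0]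
  let P : V → Finset V := fun b =>
    if side b = false ∧ 1 ≤ π b ∧ π b ≤ m then (G.neighborFinset b).filter fun a => π a = π b
    else ∅
  have hPside : ∀ b, side b = true → P b = ∅ := fun b hb => by simp [P, hb]
  have hmemP : ∀ b a, a ∈ P b ↔
      (side b = false ∧ 1 ≤ π b ∧ π b ≤ m) ∧ G.Adj b a ∧ π a = π b := by
    intro b a
    by_cases h : side b = false ∧ 1 ≤ π b ∧ π b ≤ m
    · simp only [P, if_pos h, mem_filter, SimpleGraph.mem_neighborFinset, h, true_and]
    · simp only [P, if_neg h, notMem_empty, h, false_and]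
  have hpayment : ∀ v, P v = ∅ → payment G ρ P v = 0 := fun v hv => by simp [payment, hv]
  have hcount : ∀ (v : V) (p : V → Prop) [DecidablePred p], (∀ u ∈ unpaid G ρ P v, ¬ p u) →
      (d ≤ G.degree v + s → s + 1 ≤ ((G.neighborFinset v).filter p).card) →
      (unpaid G ρ P v).card + 1 ≤ d - s := by
    intro v p _ hp hcard
    have hsub : unpaid G ρ P v ⊆ (G.neighborFinset v).filter fun u => ¬ p u := by
      intro u hu
      refine mem_filter.2 ⟨?_, hp u hu⟩
      rw [SimpleGraph.mem_neighborFinset]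
      exact (mem_filter.1 hu).2.1.symm
    have h1 := card_le_card hsub
    have h2 := card_filter_add_card_filter_not (s := G.neighborFinset v) p
    rw [SimpleGraph.card_neighborFinset_eq_degree] at h2
    have := hdeg v
    by_cases h : d ≤ G.degree v + s
    · have := hcard h
      omega
    · omega
  refine SD3.of_scheme ρ P (d - s) ?_ (fun b a ha => ((hmemP b a).1 ha).2.1) ?_ ?_
  · intro u v huv
    have := hside u v huv
    rcases hu : side u with _ | _
    · have hv : side v = true := by simpa [hu] using this
      have := hρB u hu
      have := hρA v hv
      omega
    · have hv : side v = false := by simpa [hu] using this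
      have := hρA u hu
      have := hρB v hv
      omega
  · intro b a ha
    rw [hmemP] at ha
    refine hPside a ?_
    have := hside b a ha.2.1
    simpa [ha.1.1] using this
  · intro v
    by_cases hv : side v = true
    · rw [hpayment v (hPside v hv), add_zero]
      refine hcount v (fun u => π u = π v) (fun u hu huv => ?_) (hA v hv _ (hπ v hv))
      obtain ⟨hadj, hlt, hnot⟩ := (mem_filter.1 hu).2
      have hu' : side u = false := by simpa [hv] using hside u v hadj
      rw [hmemP] at hnot
      have := hπ v hv
      have := hρA v hv
      have := hρB u hu'
      by_cases h0 : π v = 0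
      · omega
      · exact hnot ⟨⟨hu', by omega, by omega⟩, hadj, huv.symm⟩
    · have hv' : side v = false := by simpa using hv
      by_cases h0 : π v = 0
      · rw [hpayment v (by simp [P, h0]), add_zero]
        refine hcount v (fun u => 1 ≤ π u ∧ π u ≤ m) (fun u hu huv => ?_) (hB v hv')
        obtain ⟨hadj, hlt, -⟩ := (mem_filter.1 hu).2
        have hu' : side u = true := by simpa [hv'] using hside u v hadj
        have := hρA u hu'
        have := hρB v hv'
        omega
      · have hun : unpaid G ρ P v = ∅ := by
          refine filter_eq_empty_iff.2 fun u _ => ?_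
          rintro ⟨hadj, hlt, -⟩
          have hu' : side u = true := by simpa [hv'] using hside u v hadj
          have := hρA u hu'
          have := hρB v hv'
          omega
        rw [hun, card_empty, zero_add]
        by_cases hm : π v ≤ m
        · have hle := hpay v hv' (π v) (by omega) hm
          have hPv : P v = (G.neighborFinset v).filter fun a => π a = π v :=
            if_pos ⟨hv', by omega, hm⟩
          suffices payment G ρ P v ≤
              ((G.neighborFinset v).filter fun w => π w = π v).card * (1 + M (π v)) by omega
          unfold payment
          rw [← hPv, ← smul_eq_mul]
          refine sum_le_card_nsmul _ _ _ fun a ha => ?_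
          gcongr
          have hadj := ((hmemP v a).1 ha).2.1
          have ha' : side a = true := by simpa [hv'] using hside v a hadj
          refine (card_le_card fun u hu => ?_).trans (hM a ha' (π v) (by omega) hm)
          obtain ⟨hu, hle⟩ := mem_filter.1 hu
          have hua := (mem_filter.1 hu).2.1
          have hu' : side u = false := by simpa [ha'] using hside u a hua
          refine mem_filter.2 ⟨(SimpleGraph.mem_neighborFinset ..).2 hua.symm, ?_⟩
          have := hρB u hu'
          have := hρB v hv'
          omega
        · rw [hpayment v (by simp [P, hm])]
          omega

end Scheme

section Counting

open Finset

theorem card_filter_color_mem {V K : Type*} [DecidableEq K] (S : Finset V) (x : V → K)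
    (C : Finset K) :
    (S.filter fun w => x w ∈ C).card = ∑ c ∈ C, (S.filter fun w => x w = c).card := by
  rw [card_eq_sum_card_fiberwise (s := S.filter fun w => x w ∈ C) (f := x) (t := C)
    fun w hw => (mem_filter.1 hw).2]
  refine sum_congr rfl fun c hc => ?_
  rw [filter_filter]
  congr 1
  refine filter_congr fun w _ => ?_
  constructor
  · exact fun h => h.2
  · rintro rfl
    exact ⟨hc, rfl⟩

theorem le_card_filter_div_eq {N q j n : ℕ} (hN : q * (n + 1) ≤ N) (hj : j ≤ n) :
    q ≤ (univ.filter fun k : Fin N => (k : ℕ) / q = j).card := by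
  have hlt : ∀ t < q, j * q + t < N := fun t ht => by
    nlinarith [Nat.mul_le_mul_right q hj]
  calc q = (univ : Finset (Fin q)).card := by simp
    _ ≤ _ := by
      refine card_le_card_of_injOn (fun t => ⟨j * q + t, hlt t t.2⟩) (fun t _ => ?_) ?_
      · refine mem_coe.2 (mem_filter.2 ⟨mem_univ _, ?_⟩)
        simp [Nat.div_eq_of_lt_le (m := j * q + t) (n := q) (k := j) (by omega)
          (by have := t.2; rw [Nat.succ_mul]; omega)]
      · intro t _ t' _ h
        simpa [Fin.ext_iff] using h

theorem card_filter_div_le {N q i : ℕ} (hq : 0 < q) :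
    (univ.filter fun k : Fin N => (k : ℕ) / q ≤ i).card ≤ q * (i + 1) := by
  calc _ ≤ (range (q * (i + 1))).card := by
        refine card_le_card_of_injOn (fun k => (k : ℕ)) (fun k hk => ?_) fun k _ k' _ h => Fin.ext h
        have h := (mem_filter.1 hk).2
        rw [coe_range, Set.mem_Iio, mul_comm, ← Nat.div_lt_iff_lt_mul hq]
        exact Nat.lt_succ_iff.2 h
    _ = _ := card_range _

/-- A map on `ℕ` attaining the value `i` about `X / i` times. -/
noncomputable def expFloor (X : ℝ) (k : ℕ) : ℕ := ⌊Real.exp (k / X)⌋₊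

theorem card_filter_expFloor_le {N i : ℕ} {X : ℝ} (hi : 1 ≤ i) (hX : (i : ℝ) ≤ X) :
    ((univ.filter fun k : Fin N => expFloor X k = i).card : ℝ) ≤ 2 * (X / i) := by
  have hi0 : (0 : ℝ) < i := by exact_mod_cast hi
  have hX0 : 0 < X := hi0.trans_le hX
  have hcard : (univ.filter fun k : Fin N => expFloor X k = i).card ≤
      (Ico ⌈X * Real.log i⌉₊ ⌈X * Real.log (i + 1)⌉₊).card := by
    refine card_le_card_of_injOn (fun k => (k : ℕ)) (fun k hk => ?_) fun k _ k' _ h => Fin.ext h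
    have h := (mem_filter.1 hk).2
    unfold expFloor at h
    rw [Nat.floor_eq_iff (Real.exp_pos _).le] at h
    rw [coe_Ico, Set.mem_Ico, Nat.ceil_le, Nat.lt_ceil]
    constructor
    · rw [mul_comm, ← le_div_iff₀ hX0]
      exact (Real.log_le_iff_le_exp hi0).2 h.1
    · rw [mul_comm, ← div_lt_iff₀ hX0]
      exact (Real.lt_log_iff_exp_lt (by positivity)).2 h.2
  have hlog : Real.log (i + 1) ≤ Real.log i + 1 / i := by
    have h1 := Real.log_le_sub_one_of_pos (show (0 : ℝ) < (i + 1) / i by positivity)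
    rw [Real.log_div (by positivity) hi0.ne'] at h1
    have : ((i : ℝ) + 1) / i - 1 = 1 / i := by field_simp; ring
    linarith
  have hlog0 : 0 ≤ Real.log i := Real.log_nonneg (by exact_mod_cast hi)
  have hmono : ⌈X * Real.log i⌉₊ ≤ ⌈X * Real.log (i + 1)⌉₊ := by
    gcongr
    linarith
  have hone : 1 ≤ X / i := (one_le_div hi0).2 hX
  calc ((univ.filter fun k : Fin N => expFloor X k = i).card : ℝ)
      ≤ ⌈X * Real.log (i + 1)⌉₊ - ⌈X * Real.log i⌉₊ := by
        rw [← Nat.cast_sub hmono, ← Nat.card_Ico]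
        exact_mod_cast hcard
    _ ≤ X * Real.log (i + 1) + 1 - X * Real.log i := by
        have h1 := Nat.ceil_lt_add_one (show 0 ≤ X * Real.log (i + 1) by
          have : 0 ≤ Real.log ((i : ℝ) + 1) := Real.log_nonneg (by linarith)
          positivity)
        have h2 := Nat.le_ceil (X * Real.log i)
        linarith
    _ ≤ X * (Real.log i + 1 / i) + 1 - X * Real.log i := by gcongr
    _ ≤ 2 * (X / i) := by
        rw [mul_add, mul_one_div]
        linarith

theorem le_card_filter_expFloor {N n : ℕ} {X : ℝ} (hX : 0 < X) (hN : X * Real.log (n + 1) ≤ N) :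
    X * Real.log (n + 1) ≤
      (univ.filter fun k : Fin N => 1 ≤ expFloor X k ∧ expFloor X k ≤ n).card := by
  have hle : ⌈X * Real.log (n + 1)⌉₊ ≤ N := Nat.ceil_le.2 hN
  refine (Nat.le_ceil _).trans (Nat.cast_le.2 ?_)
  calc ⌈X * Real.log (n + 1)⌉₊ = (univ : Finset (Fin ⌈X * Real.log (n + 1)⌉₊)).card := by simp
    _ ≤ _ := by
      refine card_le_card_of_injOn (fun t => ⟨t, t.2.trans_le hle⟩) (fun t _ => ?_) ?_
      · have ht := Nat.lt_ceil.1 t.2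
        refine mem_coe.2 (mem_filter.2 ⟨mem_univ _, ?_, ?_⟩) <;> unfold expFloor
        · refine Nat.le_floor ?_
          rw [Nat.cast_one]
          exact Real.one_le_exp (by positivity)
        · rw [← Nat.lt_succ_iff, Nat.floor_lt (Real.exp_pos _).le, Nat.cast_succ,
            ← Real.lt_log_iff_exp_lt (by positivity), div_lt_iff₀ hX]
          linarith
      · intro t _ t' _ h
        simpa [Fin.ext_iff] using h

end Counting

open Finset in
open scoped Classical in
theorem SD3.of_coloring {V : Type*} [Fintype V] {G : SimpleGraph V} {side : V → Bool}
    (hside : ∀ u v, G.Adj u v → side u ≠ side v) {d s n N q : ℕ} {X y : ℝ}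
    (hdeg : ∀ v, G.degree v ≤ d) (hs : 2 * s ≤ d) (hq : 0 < q) (hqN : q * (n + 1) ≤ N)
    (hX0 : 0 < X) (hnX : (n : ℝ) ≤ X) (hXN : X * Real.log (n + 1) ≤ N)
    (hsq : (s : ℝ) + 1 ≤ q * (y / 8)) (hsX : (s : ℝ) + 1 ≤ X * Real.log (n + 1) * (y / 8))
    (hcost : 20 * X * q * y ^ 2 + s + 1 ≤ d) (x : V → Fin N)
    (hx : ∀ v c, (((G.neighborFinset v).filter fun w => x w = c).card : ℝ) ≤ 2 * y ∧
      ((d : ℝ) / 2 ≤ G.degree v → y / 8 ≤ ((G.neighborFinset v).filter fun w => x w = c).card)) :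
    SD3 G fun _ => d - s := by
  have hq0 : (0 : ℝ) < q := by exact_mod_cast hq
  have hy : 0 < y := by
    have : (0 : ℝ) < q * (y / 8) := lt_of_lt_of_le (by positivity) hsq
    have := (mul_pos_iff_of_pos_left hq0).1 this
    linarith
  have hsd : s + 1 ≤ d := by
    have : (s : ℝ) + 1 ≤ d := le_trans (by
      have : 0 ≤ 20 * X * q * y ^ 2 := by positivity
      linarith) hcost
    exact_mod_cast this
  have hupper : ∀ v (C : Finset (Fin N)),
      (((G.neighborFinset v).filter fun w => x w ∈ C).card : ℝ) ≤ C.card * (2 * y) := by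
    intro v C
    rw [card_filter_color_mem, Nat.cast_sum, ← nsmul_eq_mul]
    exact sum_le_card_nsmul _ _ _ fun c _ => (hx v c).1
  have hlower : ∀ v (C : Finset (Fin N)), d ≤ G.degree v + s →
      C.card * (y / 8) ≤ ((G.neighborFinset v).filter fun w => x w ∈ C).card := by
    intro v C hv
    rw [card_filter_color_mem, Nat.cast_sum, ← nsmul_eq_mul]
    refine card_nsmul_le_sum _ _ _ fun c _ => (hx v c).2 ?_
    have h1 : (d : ℝ) ≤ G.degree v + s := by exact_mod_cast hv
    have h2 : (2 * s : ℝ) ≤ d := by exact_mod_cast hs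
    linarith
  let π : V → ℕ := fun v =>
    if side v = true then (if expFloor X (x v) ≤ n then expFloor X (x v) else 0) else x v / q
  have hπA : ∀ b w, side b = false → w ∈ G.neighborFinset b →
      π w = if expFloor X (x w) ≤ n then expFloor X (x w) else 0 := by
    intro b w hb hw
    have : side w = true := by
      simpa [hb] using hside b w ((SimpleGraph.mem_neighborFinset ..).1 hw)
    simp [π, this]
  have hπB : ∀ a w, side a = true → w ∈ G.neighborFinset a → π w = x w / q := by
    intro a w ha hw
    have : side w = false := by
      simpa [ha] using hside a w ((SimpleGraph.mem_neighborFinset ..).1 hw)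
    simp [π, this]
  refine SD3.of_parts hside (m := n) hsd hdeg π ?_ (fun i => ⌊(q * (i + 1) : ℕ) * (2 * y)⌋₊)
    ?_ ?_ ?_ ?_
  · intro a ha
    simp only [π, ha, if_true]
    split_ifs <;> omega
  · intro a ha j hj hda
    have h := hlower a (univ.filter fun k : Fin N => (k : ℕ) / q = j) hda
    have hcard : (q : ℝ) ≤ (univ.filter fun k : Fin N => (k : ℕ) / q = j).card := by
      exact_mod_cast le_card_filter_div_eq hqN hj
    have heq : ((G.neighborFinset a).filter fun w => π w = j) =
        (G.neighborFinset a).filter fun w =>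
          x w ∈ univ.filter fun k : Fin N => (k : ℕ) / q = j := by
      refine filter_congr fun w hw => ?_
      simp [hπB a w ha hw]
    rw [heq]
    have : (s : ℝ) + 1 ≤ ((G.neighborFinset a).filter fun w =>
        x w ∈ univ.filter fun k : Fin N => (k : ℕ) / q = j).card :=
      hsq.trans ((mul_le_mul_of_nonneg_right hcard (by positivity)).trans h)
    exact_mod_cast this
  · intro b hb hdb
    have h := hlower b
      (univ.filter fun k : Fin N => 1 ≤ expFloor X k ∧ expFloor X k ≤ n) hdb
    have hcard := le_card_filter_expFloor hX0 hXN
    have heq : ((G.neighborFinset b).filter fun w => 1 ≤ π w ∧ π w ≤ n) =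
        (G.neighborFinset b).filter fun w =>
          x w ∈ univ.filter fun k : Fin N => 1 ≤ expFloor X k ∧ expFloor X k ≤ n := by
      refine filter_congr fun w hw => ?_
      rw [hπA b w hb hw]
      simp only [mem_filter, mem_univ, true_and]
      split_ifs <;> omega
    rw [heq]
    have : (s : ℝ) + 1 ≤ ((G.neighborFinset b).filter fun w =>
        x w ∈ univ.filter fun k : Fin N => 1 ≤ expFloor X k ∧ expFloor X k ≤ n).card :=
      hsX.trans ((mul_le_mul_of_nonneg_right hcard (by positivity)).trans h)
    exact_mod_cast this
  · intro a ha i _ _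
    have heq : ((G.neighborFinset a).filter fun w => π w ≤ i) =
        (G.neighborFinset a).filter fun w =>
          x w ∈ univ.filter fun k : Fin N => (k : ℕ) / q ≤ i := by
      refine filter_congr fun w hw => ?_
      simp [hπB a w ha hw]
    rw [heq]
    refine Nat.le_floor ((hupper a _).trans ?_)
    gcongr
    exact card_filter_div_le hq
  · intro b hb i hi hin
    have heq : ((G.neighborFinset b).filter fun w => π w = i) =
        (G.neighborFinset b).filter fun w =>
          x w ∈ univ.filter fun k : Fin N => expFloor X k = i := by
      refine filter_congr fun w hw => ?_
      rw [hπA b w hb hw]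
      simp only [mem_filter, mem_univ, true_and]
      split_ifs <;> omega
    rw [heq]
    have hi0 : (1 : ℝ) ≤ i := by exact_mod_cast hi
    have h1 : (((G.neighborFinset b).filter fun w =>
        x w ∈ univ.filter fun k : Fin N => expFloor X k = i).card : ℝ) ≤
        2 * (X / i) * (2 * y) := by
      refine (hupper b _).trans ?_
      gcongr
      exact card_filter_expFloor_le hi (le_trans (by exact_mod_cast hin) hnX)
    have h2 : 1 + (⌊((q * (i + 1) : ℕ) : ℝ) * (2 * y)⌋₊ : ℝ) ≤ 5 * i * (q * y) := by
      have hfl := Nat.floor_le (show 0 ≤ ((q * (i + 1) : ℕ) : ℝ) * (2 * y) by positivity)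
      push_cast at hfl ⊢
      have hqy : 1 ≤ q * y := by
        have : (0 : ℝ) ≤ s := by positivity
        linarith
      nlinarith
    have h3 : (((G.neighborFinset b).filter fun w =>
        x w ∈ univ.filter fun k : Fin N => expFloor X k = i).card : ℝ) *
        (1 + (⌊((q * (i + 1) : ℕ) : ℝ) * (2 * y)⌋₊ : ℝ)) + s + 1 ≤ d := by
      refine le_trans ?_ hcost
      gcongr ?_ + _ + _
      refine (mul_le_mul h1 h2 (by positivity) (by positivity)).trans (le_of_eq ?_)
      field_simp
      ring
    exact_mod_cast h3

set_option maxHeartbeats 1000000 in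
/-- The numerical conditions needed to apply `SD3.of_coloring` and `exists_balanced_coloring`. -/
theorem eventually_parameters : ∃ n₀ : ℕ, ∀ n d : ℕ, n₀ ≤ n → n ^ 8 ≤ d → d < (n + 1) ^ 8 →
    1 ≤ d ∧ 0 < n ^ 6 ∧ ∃ (q : ℕ) (X : ℝ),
      2 * ⌈1 / 1000 * √(d * Real.log d)⌉₊ ≤ d ∧ 0 < q ∧ q * (n + 1) ≤ n ^ 6 ∧
      0 < X ∧ (n : ℝ) ≤ X ∧ X * Real.log (n + 1) ≤ (n ^ 6 : ℕ) ∧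
      (⌈1 / 1000 * √(d * Real.log d)⌉₊ : ℝ) + 1 ≤ q * ((d : ℝ) / (n ^ 6 : ℕ) / 8) ∧
      (⌈1 / 1000 * √(d * Real.log d)⌉₊ : ℝ) + 1 ≤
        X * Real.log (n + 1) * ((d : ℝ) / (n ^ 6 : ℕ) / 8) ∧
      20 * X * q * ((d : ℝ) / (n ^ 6 : ℕ)) ^ 2 + ⌈1 / 1000 * √(d * Real.log d)⌉₊ + 1 ≤ d ∧
      8 * (d : ℝ) ^ 2 * (n ^ 6 : ℕ) * Real.exp (-((d : ℝ) / (n ^ 6 : ℕ)) / 8) ≤ 1 := by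
  obtain ⟨n₁, hn₁⟩ : ∃ n₁ : ℕ, ∀ n : ℕ, n₁ ≤ n →
      (n : ℝ) ^ 22 * Real.exp (-(n : ℝ)) ≤ 1 / 524288 := by
    have h := (Real.tendsto_pow_mul_exp_neg_atTop_nhds_zero 22).comp
      (tendsto_natCast_atTop_atTop (R := ℝ))
    exact Filter.eventually_atTop.1 (h.eventually (eventually_le_nhds (by norm_num)))
  refine ⟨max n₁ 1000000, fun n d hn hnd hdn => ?_⟩
  have hn' : (1000000 : ℝ) ≤ n := by exact_mod_cast (le_max_right _ _).trans hn
  have hexp := hn₁ n ((le_max_left _ _).trans hn)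
  have hn0 : (0 : ℝ) < n := by linarith
  have hd_lower : (n : ℝ) ^ 8 ≤ d := by exact_mod_cast hnd
  have hd_upper : (d : ℝ) ≤ 256 * (n : ℝ) ^ 8 := by
    have h1 : (d : ℝ) ≤ ((n : ℝ) + 1) ^ 8 := by exact_mod_cast hdn.le
    calc (d : ℝ) ≤ ((n : ℝ) + 1) ^ 8 := h1
      _ ≤ (2 * (n : ℝ)) ^ 8 := by gcongr; linarith
      _ = _ := by ring
  have hd0 : (0 : ℝ) < d := lt_of_lt_of_le (by positivity) hd_lower
  have hd1 : 1 ≤ d := by exact_mod_cast (Nat.cast_pos (α := ℝ)).1 hd0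
  set l := Real.log n with hl
  have hl1 : 1 ≤ l := by
    rw [hl, Real.le_log_iff_exp_le hn0]
    linarith [Real.exp_one_lt_d9]
  have hln : l ≤ n := (Real.log_le_sub_one_of_pos hn0).trans (by linarith)
  set L := Real.log d with hL
  have hL_lower : 8 * l ≤ L := by
    have := Real.log_le_log (by positivity) hd_lower
    rwa [Real.log_pow] at this
  have hL_upper : L ≤ 16 * l := by
    have h1 : (d : ℝ) ≤ (n : ℝ) ^ 16 := by
      refine hd_upper.trans ?_
      have : (256 : ℝ) ≤ (n : ℝ) ^ 8 := by
        calc (256 : ℝ) ≤ n := by linarith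
          _ ≤ (n : ℝ) ^ 8 := le_self_pow₀ (by linarith) (by norm_num)
      calc 256 * (n : ℝ) ^ 8 ≤ (n : ℝ) ^ 8 * (n : ℝ) ^ 8 := by gcongr
        _ = _ := by ring
    have := Real.log_le_log hd0 h1
    rwa [Real.log_pow] at this
  have hL0 : 0 < L := by linarith
  have hlog_succ : Real.log (n + 1) ≤ 2 * l := by
    have h1 : (n : ℝ) + 1 ≤ (n : ℝ) ^ 2 := by nlinarith
    have := Real.log_le_log (by positivity) h1
    rwa [Real.log_pow] at this
  have hlog_succ' : l ≤ Real.log (n + 1) := Real.log_le_log hn0 (by linarith)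
  set z := √(L / d) with hz
  have hz2 : z ^ 2 = L / d := Real.sq_sqrt (by positivity)
  have hz0 : 0 < z := Real.sqrt_pos.2 (by positivity)
  have hT : √(d * L) = d * z := by
    rw [Real.sqrt_eq_iff_eq_sq (by positivity) (by positivity), mul_pow, hz2]
    field_simp
  rw [hT]
  push_cast
  set N := (n : ℝ) ^ 6 with hN
  have hN0 : 0 < N := by positivity
  have hNz2 : (n : ℝ) ^ 4 * l / 32 ≤ (N * z) ^ 2 := by
    rw [mul_pow, hz2, ← mul_div_assoc, div_le_div_iff₀ (by norm_num) hd0]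
    calc (n : ℝ) ^ 4 * l * d ≤ (n : ℝ) ^ 4 * l * (256 * (n : ℝ) ^ 8) := by gcongr
      _ = N ^ 2 * (8 * l) * 32 := by rw [hN]; ring
      _ ≤ N ^ 2 * L * 32 := by gcongr
  have hNz : (n : ℝ) ^ 2 / 6 ≤ N * z := by
    refine le_of_sq_le_sq ?_ (by positivity)
    refine le_trans ?_ hNz2
    have : (n : ℝ) ^ 4 * 1 ≤ (n : ℝ) ^ 4 * l := by gcongr
    have : (0 : ℝ) ≤ (n : ℝ) ^ 4 := by positivity
    calc ((n : ℝ) ^ 2 / 6) ^ 2 = (n : ℝ) ^ 4 / 36 := by ring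
      _ ≤ (n : ℝ) ^ 4 * l / 32 := by linarith
  have hNz100 : 100 ≤ N * z := by nlinarith
  have hzn : z ≤ 1 / (n : ℝ) ^ 2 := by
    refine le_of_sq_le_sq ?_ (by positivity)
    rw [hz2, div_pow, one_pow, ← pow_mul, div_le_div_iff₀ hd0 (by positivity), one_mul]
    calc L * (n : ℝ) ^ (2 * 2) ≤ (16 * n) * (n : ℝ) ^ (2 * 2) := by
          gcongr
          linarith
      _ ≤ (n * n) * (n : ℝ) ^ (2 * 2) := by gcongr; linarith
      _ = (n : ℝ) ^ 6 := by ring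
      _ ≤ (n : ℝ) ^ 8 := pow_le_pow_right₀ (by linarith) (by norm_num)
      _ ≤ d := hd_lower
  have hz1 : z ≤ 1 := hzn.trans (by
    rw [div_le_one (by positivity)]
    exact one_le_pow₀ (by linarith))
  have hdz : 8000 ≤ d * z := by
    rw [← hT]
    refine Real.le_sqrt_of_sq_le ?_
    have h1 : (n : ℝ) ^ 2 ≤ d := (pow_le_pow_right₀ (by linarith) (by norm_num)).trans hd_lower
    nlinarith
  set s := ⌈1 / 1000 * (d * z)⌉₊ with hs
  have hs_upper : (s : ℝ) + 1 ≤ d * z / 800 := by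
    have := Nat.ceil_lt_add_one (show 0 ≤ 1 / 1000 * (d * z) by positivity)
    linarith
  have hs_d : (s : ℝ) + 1 ≤ d / 800 := hs_upper.trans (by nlinarith)
  set q := ⌈N * z / 100⌉₊ with hq
  have hq_lower : N * z / 100 ≤ q := Nat.le_ceil _
  have hq_upper : (q : ℝ) ≤ N * z / 50 := by
    have := Nat.ceil_lt_add_one (show 0 ≤ N * z / 100 by positivity)
    linarith
  set X := N * z / (100 * l) with hX
  have hX0 : 0 < X := by positivity
  have hXl : X * l = N * z / 100 := by rw [hX]; field_simp
  have hy0 : 0 < (d : ℝ) / N := by positivity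
  refine ⟨hd1, ?_, q, X, ?_, ?_, ?_, hX0, ?_, ?_, ?_, ?_, ?_, ?_⟩
  · have : 0 < n := by exact_mod_cast hn0
    positivity
  · have : (2 : ℝ) * s ≤ d := by linarith
    exact_mod_cast this
  · have : (0 : ℝ) < q := by linarith
    exact_mod_cast this
  · have : (q : ℝ) * (n + 1) ≤ N := by
      calc (q : ℝ) * (n + 1) ≤ N * (1 / (n : ℝ) ^ 2) / 50 * (2 * n) := by
            gcongr
            · exact hq_upper.trans (by gcongr)
            · linarith
        _ = N * (2 / (50 * n)) := by field_simp
        _ ≤ N * 1 := by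
            gcongr
            rw [div_le_one (by positivity)]
            linarith
        _ = N := mul_one N
    rw [hN] at this
    exact_mod_cast this
  · refine le_of_sq_le_sq ?_ hX0.le
    rw [hX, div_pow, le_div_iff₀ (by positivity)]
    refine le_trans ?_ hNz2
    have h1 : 320000 * l ≤ (n : ℝ) ^ 2 := by nlinarith
    calc (n : ℝ) ^ 2 * (100 * l) ^ 2 = (n : ℝ) ^ 2 * l / 32 * (320000 * l) := by ring
      _ ≤ (n : ℝ) ^ 2 * l / 32 * (n : ℝ) ^ 2 := by gcongr
      _ = _ := by ring
  · calc X * Real.log (n + 1) ≤ X * (2 * l) := by gcongr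
      _ = N * z / 50 := by linarith
      _ ≤ N := by nlinarith
  · refine hs_upper.trans ?_
    calc d * z / 800 = N * z / 100 * (d / N / 8) := by field_simp; norm_num
      _ ≤ q * (d / N / 8) := by gcongr
  · refine hs_upper.trans ?_
    calc d * z / 800 = X * l * (d / N / 8) := by rw [hXl]; field_simp; norm_num
      _ ≤ X * Real.log (n + 1) * (d / N / 8) := by gcongr
  · have h1 : 20 * X * q * ((d : ℝ) / N) ^ 2 ≤ d / 10 := by
      calc 20 * X * q * ((d : ℝ) / N) ^ 2
          ≤ 20 * X * (N * z / 50) * ((d : ℝ) / N) ^ 2 := by gcongr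
        _ = z ^ 2 * d ^ 2 / (250 * l) := by rw [hX]; field_simp; norm_num
        _ = d * (L / (250 * l)) := by rw [hz2]; field_simp
        _ ≤ d * (1 / 10) := by
            refine mul_le_mul_of_nonneg_left ?_ hd0.le
            rw [div_le_div_iff₀ (by positivity) (by norm_num)]
            linarith
        _ = d / 10 := by ring
    linarith
  · have h1 : (n : ℝ) ≤ d / N / 8 := by
      rw [div_div, le_div_iff₀ (by positivity), hN]
      refine le_trans ?_ hd_lower
      have : (n : ℝ) ^ 7 * 8 ≤ (n : ℝ) ^ 7 * n := by gcongr; linarith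
      nlinarith
    calc 8 * (d : ℝ) ^ 2 * N * Real.exp (-((d : ℝ) / N) / 8)
        ≤ 8 * (256 * (n : ℝ) ^ 8) ^ 2 * N * Real.exp (-(n : ℝ)) := by
          gcongr
          linarith
      _ = 524288 * ((n : ℝ) ^ 22 * Real.exp (-(n : ℝ))) := by rw [hN]; ring
      _ ≤ 524288 * (1 / 524288) := by gcongr
      _ = 1 := by norm_num

/-- There is `d₀` such that for all `d ≥ d₀`, every bipartite graph of
maximum degree at most `d` satisfies `sd³(G) ≤ d - (1/1000)·√(d log d)`. -/
theorem statement16 :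
    ∃ d₀ : ℕ, ∀ d : ℕ, d₀ ≤ d →
      ∀ (V : Type) [Fintype V] (G : SimpleGraph V) [DecidableRel G.Adj],
        G.Colorable 2 →
        (∀ v, G.degree v ≤ d) →
        (sd3 G : ℝ) ≤ (d : ℝ) - (1 / 1000) * Real.sqrt (d * Real.log d) := by
  classical
  obtain ⟨n₀, hn₀⟩ := eventually_parameters
  refine ⟨n₀ ^ 8, fun d hd V _ G _ hcol hdeg => ?_⟩
  have hroot : d < (Nat.nthRoot 8 d + 1) ^ 8 := Nat.lt_pow_nthRoot_add_one (by norm_num) d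
  have hn : n₀ ≤ Nat.nthRoot 8 d :=
    Nat.lt_succ_iff.1 (lt_of_pow_lt_pow_left₀ 8 (Nat.zero_le _) (hd.trans_lt hroot))
  obtain ⟨hd1, hN, q, X, hs, hq, hqN, hX0, hnX, hXN, hsq, hsX, hcost, hK⟩ :=
    hn₀ _ d hn (Nat.pow_nthRoot_le (by norm_num)) hroot
  set n := Nat.nthRoot 8 d
  set s := ⌈1 / 1000 * √(d * Real.log d)⌉₊
  have : Nonempty (Fin (n ^ 6)) := ⟨⟨0, hN⟩⟩
  obtain ⟨x, hx⟩ := exists_balanced_coloring (K := Fin (n ^ 6)) G hdeg hd1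
    (by rwa [Fintype.card_fin])
  rw [Fintype.card_fin] at hx
  obtain ⟨col⟩ := hcol
  have hside : ∀ u v, G.Adj u v → decide (col u = 0) ≠ decide (col v = 0) := by
    intro u v huv
    have := col.valid huv
    rw [Ne, decide_eq_decide]
    omega
  have hSD : SD3 G fun _ => d - s := by
    refine SD3.of_coloring hside (n := n) (fun v => ?_) hs hq hqN hX0 hnX hXN hsq hsX hcost x ?_
    · convert hdeg v
    · convert hx
  have hle : sd3 G ≤ d - s := Nat.sInf_le hSD
  have hcast : (sd3 G : ℝ) ≤ ((d - s : ℕ) : ℝ) := by exact_mod_cast hle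
  rw [Nat.cast_sub (by omega)] at hcast
  have := Nat.le_ceil (1 / 1000 * √(d * Real.log d))
  linarith
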